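/- Fix t₀ < t_f, dimensions n, m, a nonempty compact set U ⊆ ℝ^m, a continuous map f̃ : ℝ × ℝⁿ × ℝ^m → ℝⁿ, an integer r ≥ 1, orders v₁, …, v_r > 0, continuous functions g₁, …, g_r : ℝ × ℝⁿ × ℝ^m → ℝ, and a continuous terminal cost h : ℝⁿ → ℝ. Assume the value function V is real-valued on [t₀, t_f] × ℝⁿ, and let (x*, u*) be an optimal admissible pair from (t₀, x₀), i.e., J(t₀, x₀; x*, u*) = V(t₀, x₀). Let t ∈ [t₀, t_f) be such that V is differentiable at (t, x*(t)) and u* is right-continuous at t. Then the following supersolution inequality holds along the optimal trajectory: ∂V/∂t (t, x*(t)) + Σ_{j=1}^r (1/Γ(v_j)) (t_f − t)^{v_j−1} g_j(t, x*(t), u*(t)) + ⟨∇_x V(t, x*(t)), f̃(t, x*(t), u*(t))⟩ ≤ 0. -/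

import Mathlib

open MeasureTheory Set

noncomputable section

/-- An **admissible pair** `(x, u)` from `(t, x₀)` for the controlled dynamics
`ẋ = f̃(τ, x, u)` on `[t, t_f]`: `u` is a measurable control taking values in the
control set `U`, and `x` is a continuous trajectory satisfying the integral form of
the dynamics, `x(τ) = x₀ + ∫_t^τ f̃(σ, x(σ), u(σ)) dσ` for all `τ ∈ [t, t_f]`. -/
structure AdmissiblePair (tf : ℝ) {n m : ℕ} (U : Set (EuclideanSpace ℝ (Fin m)))
    (ftil : ℝ → EuclideanSpace ℝ (Fin n) → EuclideanSpace ℝ (Fin m) →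
      EuclideanSpace ℝ (Fin n))
    (t : ℝ) (x0 : EuclideanSpace ℝ (Fin n)) where
  x : ℝ → EuclideanSpace ℝ (Fin n)
  u : ℝ → EuclideanSpace ℝ (Fin m)
  u_mem : ∀ τ ∈ Icc t tf, u τ ∈ U
  u_meas : Measurable ((Icc t tf).restrict u)
  x_cont : ContinuousOn x (Icc t tf)
  x_eq : ∀ τ ∈ Icc t tf, x τ = x0 + ∫ σ in t..τ, ftil σ (x σ) (u σ)

/-- The **generalized (fractional-order) performance index** of an admissible pair:
`J(t, x₀; x, u) = Σ_j (1/Γ(v_j)) ∫_t^{t_f} (t_f - τ)^(v_j - 1) g_j(τ, x(τ), u(τ)) dτ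
  + h(x(t_f))`, with kernels anchored at the fixed final time `t_f`. -/
def fracCost (tf : ℝ) {n m : ℕ} {U : Set (EuclideanSpace ℝ (Fin m))}
    {ftil : ℝ → EuclideanSpace ℝ (Fin n) → EuclideanSpace ℝ (Fin m) →
      EuclideanSpace ℝ (Fin n)}
    {r : ℕ} (v : Fin r → ℝ)
    (g : Fin r → ℝ → EuclideanSpace ℝ (Fin n) → EuclideanSpace ℝ (Fin m) → ℝ)
    (h : EuclideanSpace ℝ (Fin n) → ℝ)
    {t : ℝ} {x0 : EuclideanSpace ℝ (Fin n)} (p : AdmissiblePair tf U ftil t x0) : ℝ :=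
  (∑ j, (1 / Real.Gamma (v j)) *
      ∫ τ in t..tf, (tf - τ) ^ (v j - 1) * g j τ (p.x τ) (p.u τ)) + h (p.x tf)

/-- The **value function**: the infimum, in the extended reals, of the generalized
performance index over all admissible pairs from `(t, x₀)`. -/
def fracValue (tf : ℝ) {n m : ℕ} (U : Set (EuclideanSpace ℝ (Fin m)))
    (ftil : ℝ → EuclideanSpace ℝ (Fin n) → EuclideanSpace ℝ (Fin m) →
      EuclideanSpace ℝ (Fin n))
    {r : ℕ} (v : Fin r → ℝ)
    (g : Fin r → ℝ → EuclideanSpace ℝ (Fin n) → EuclideanSpace ℝ (Fin m) → ℝ)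
    (h : EuclideanSpace ℝ (Fin n) → ℝ)
    (t : ℝ) (x0 : EuclideanSpace ℝ (Fin n)) : EReal :=
  ⨅ p : AdmissiblePair tf U ftil t x0, ((fracCost tf v g h p : ℝ) : EReal)

/-- The integrand of the fractional performance index along the curve `(x, u)`. -/
def fracRunningCost (tf : ℝ) {n m r : ℕ} (v : Fin r → ℝ)
    (g : Fin r → ℝ → EuclideanSpace ℝ (Fin n) → EuclideanSpace ℝ (Fin m) → ℝ)
    (x : ℝ → EuclideanSpace ℝ (Fin n)) (u : ℝ → EuclideanSpace ℝ (Fin m)) (τ : ℝ) : ℝ :=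
  ∑ j, (1 / Real.Gamma (v j)) * ((tf - τ) ^ (v j - 1) * g j τ (x τ) (u τ))

theorem intervalIntegrable_sub_rpow {a b c v : ℝ} (hv : 0 < v) :
    IntervalIntegrable (fun τ => (c - τ) ^ (v - 1)) volume a b := by
  have h := (intervalIntegral.intervalIntegrable_rpow' (a := c - a) (b := c - b)
    (r := v - 1) (by linarith)).comp_sub_left c
  simpa using h

theorem fracRunningCost_continuousWithinAt {tf : ℝ} {n m r : ℕ} {v : Fin r → ℝ}
    {g : Fin r → ℝ → EuclideanSpace ℝ (Fin n) → EuclideanSpace ℝ (Fin m) → ℝ}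
    (hg : ∀ j, Continuous fun p : ℝ × EuclideanSpace ℝ (Fin n) × EuclideanSpace ℝ (Fin m) =>
      g j p.1 p.2.1 p.2.2)
    {x : ℝ → EuclideanSpace ℝ (Fin n)} {u : ℝ → EuclideanSpace ℝ (Fin m)} {t : ℝ} {s : Set ℝ}
    (ht : t < tf) (hx : ContinuousWithinAt x s t) (hu : ContinuousWithinAt u s t) :
    ContinuousWithinAt (fracRunningCost tf v g x u) s t := by
  refine tendsto_finsetSum _ fun j _ => ContinuousWithinAt.mul continuousWithinAt_const ?_
  refine ContinuousWithinAt.mul ?_ ?_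
  · exact (continuousWithinAt_const.sub continuousWithinAt_id).rpow_const
      (Or.inl (sub_pos.2 ht).ne')
  · exact (hg j).continuousAt.comp_continuousWithinAt
      (f := fun τ => (τ, x τ, u τ)) (continuousWithinAt_id.prodMk (hx.prodMk hu))

namespace AdmissiblePair

variable {tf : ℝ} {n m : ℕ} {U : Set (EuclideanSpace ℝ (Fin m))}
  {ftil : ℝ → EuclideanSpace ℝ (Fin n) → EuclideanSpace ℝ (Fin m) → EuclideanSpace ℝ (Fin n)}
  {a : ℝ} {x0 : EuclideanSpace ℝ (Fin n)}

theorem x_initial (p : AdmissiblePair tf U ftil a x0) (ha : a ≤ tf) : p.x a = x0 := by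
  simpa using p.x_eq a (left_mem_Icc.2 ha)

theorem aestronglyMeasurable_comp {G : Type*} [NormedAddCommGroup G]
    (p : AdmissiblePair tf U ftil a x0) (ha : a ≤ tf)
    {φ : ℝ → EuclideanSpace ℝ (Fin n) → EuclideanSpace ℝ (Fin m) → G}
    (hφ : Continuous fun p : ℝ × EuclideanSpace ℝ (Fin n) × EuclideanSpace ℝ (Fin m) =>
      φ p.1 p.2.1 p.2.2) :
    AEStronglyMeasurable (fun τ => φ τ (p.x τ) (p.u τ)) (volume.restrict (Icc a tf)) := by
  have hx := p.x_cont.aestronglyMeasurable (μ := volume) measurableSet_Icc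
  have hu : AEStronglyMeasurable p.u (volume.restrict (Icc a tf)) := by
    have hm : Measurable (IccExtend ha ((Icc a tf).domRestrict p.u)) :=
      p.u_meas.comp continuous_projIcc.measurable
    refine hm.aestronglyMeasurable.congr ?_
    filter_upwards [ae_restrict_mem measurableSet_Icc] with τ hτ
    rw [IccExtend_of_mem ha _ hτ, domRestrict_apply]
  exact hφ.comp_aestronglyMeasurable
    (measurable_id.aestronglyMeasurable.prodMk (hx.prodMk hu))

theorem exists_norm_comp_le {G : Type*} [NormedAddCommGroup G]
    (p : AdmissiblePair tf U ftil a x0) (hUc : IsCompact U)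
    {φ : ℝ → EuclideanSpace ℝ (Fin n) → EuclideanSpace ℝ (Fin m) → G}
    (hφ : Continuous fun p : ℝ × EuclideanSpace ℝ (Fin n) × EuclideanSpace ℝ (Fin m) =>
      φ p.1 p.2.1 p.2.2) :
    ∃ C, ∀ τ ∈ Icc a tf, ‖φ τ (p.x τ) (p.u τ)‖ ≤ C := by
  have hK : IsCompact (Icc a tf ×ˢ ((p.x '' Icc a tf) ×ˢ U)) :=
    isCompact_Icc.prod ((isCompact_Icc.image_of_continuousOn p.x_cont).prod hUc)
  obtain ⟨C, hC⟩ := hK.exists_bound_of_continuousOn hφ.continuousOn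
  exact ⟨C, fun τ hτ => hC (τ, p.x τ, p.u τ) ⟨hτ, mem_image_of_mem _ hτ, p.u_mem τ hτ⟩⟩

theorem intervalIntegrable_mul_comp (p : AdmissiblePair tf U ftil a x0) (ha : a ≤ tf)
    (hUc : IsCompact U) {k : ℝ → ℝ} (hk : IntervalIntegrable k volume a tf)
    {φ : ℝ → EuclideanSpace ℝ (Fin n) → EuclideanSpace ℝ (Fin m) → ℝ}
    (hφ : Continuous fun p : ℝ × EuclideanSpace ℝ (Fin n) × EuclideanSpace ℝ (Fin m) =>
      φ p.1 p.2.1 p.2.2) :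
    IntervalIntegrable (fun τ => k τ * φ τ (p.x τ) (p.u τ)) volume a tf := by
  obtain ⟨C, hC⟩ := p.exists_norm_comp_le hUc hφ
  rw [intervalIntegrable_iff_integrableOn_Icc_of_le ha] at hk ⊢
  refine Integrable.mul_bdd (c := C) hk (p.aestronglyMeasurable_comp ha hφ) ?_
  filter_upwards [ae_restrict_mem measurableSet_Icc] with τ hτ using hC τ hτ

theorem intervalIntegrable_dynamics (p : AdmissiblePair tf U ftil a x0) (ha : a ≤ tf)
    (hUc : IsCompact U)
    (hftil : Continuous fun p : ℝ × EuclideanSpace ℝ (Fin n) × EuclideanSpace ℝ (Fin m) =>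
      ftil p.1 p.2.1 p.2.2) :
    IntervalIntegrable (fun τ => ftil τ (p.x τ) (p.u τ)) volume a tf := by
  obtain ⟨C, hC⟩ := p.exists_norm_comp_le hUc hftil
  rw [intervalIntegrable_iff_integrableOn_Icc_of_le ha]
  refine IntegrableOn.of_bound (by simp) (p.aestronglyMeasurable_comp ha hftil) C ?_
  filter_upwards [ae_restrict_mem measurableSet_Icc] with τ hτ using hC τ hτ

section Cost

variable {r : ℕ} {v : Fin r → ℝ}
  {g : Fin r → ℝ → EuclideanSpace ℝ (Fin n) → EuclideanSpace ℝ (Fin m) → ℝ}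
  {h : EuclideanSpace ℝ (Fin n) → ℝ}

theorem intervalIntegrable_fracRunningCost (p : AdmissiblePair tf U ftil a x0) (ha : a ≤ tf)
    (hUc : IsCompact U) (hv : ∀ j, 0 < v j)
    (hg : ∀ j, Continuous fun p : ℝ × EuclideanSpace ℝ (Fin n) × EuclideanSpace ℝ (Fin m) =>
      g j p.1 p.2.1 p.2.2) :
    IntervalIntegrable (fracRunningCost tf v g p.x p.u) volume a tf := by
  have := IntervalIntegrable.sum (μ := volume) (a := a) (b := tf) Finset.univ
    (f := fun j τ => (1 / Real.Gamma (v j)) * ((tf - τ) ^ (v j - 1) * g j τ (p.x τ) (p.u τ)))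
    fun j _ => (p.intervalIntegrable_mul_comp ha hUc
      (intervalIntegrable_sub_rpow (hv j)) (hg j)).const_mul _
  refine this.congr fun τ _ => ?_
  simp [fracRunningCost]

theorem fracCost_eq (p : AdmissiblePair tf U ftil a x0) (ha : a ≤ tf)
    (hUc : IsCompact U) (hv : ∀ j, 0 < v j)
    (hg : ∀ j, Continuous fun p : ℝ × EuclideanSpace ℝ (Fin n) × EuclideanSpace ℝ (Fin m) =>
      g j p.1 p.2.1 p.2.2) :
    fracCost tf v g h p = (∫ τ in a..tf, fracRunningCost tf v g p.x p.u τ) + h (p.x tf) := by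
  unfold fracCost fracRunningCost
  rw [intervalIntegral.integral_finsetSum]
  · simp only [intervalIntegral.integral_const_mul]
  · exact fun j _ => (p.intervalIntegrable_mul_comp ha hUc
      (intervalIntegrable_sub_rpow (hv j)) (hg j)).const_mul _

end Cost

/-- The restriction of an admissible pair to a final subinterval. -/
def tail (p : AdmissiblePair tf U ftil a x0) {s : ℝ} (hs : s ∈ Icc a tf)
    (hf : IntervalIntegrable (fun τ => ftil τ (p.x τ) (p.u τ)) volume a tf) :
    AdmissiblePair tf U ftil s (p.x s) where
  x := p.x
  u := p.u
  u_mem τ hτ := p.u_mem τ ⟨hs.1.trans hτ.1, hτ.2⟩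
  u_meas := p.u_meas.comp (measurable_inclusion (Icc_subset_Icc_left hs.1))
  x_cont := p.x_cont.mono (Icc_subset_Icc_left hs.1)
  x_eq τ hτ := by
    have hτa : τ ∈ Icc a tf := ⟨hs.1.trans hτ.1, hτ.2⟩
    have hat : a ≤ tf := hs.1.trans hs.2
    rw [p.x_eq τ hτa, p.x_eq s hs, add_assoc,
      intervalIntegral.integral_add_adjacent_intervals]
    · exact hf.mono_set (by
        rw [uIcc_of_le hs.1, uIcc_of_le hat]; exact Icc_subset_Icc_right hs.2)
    · exact hf.mono_set (by
        rw [uIcc_of_le hτ.1, uIcc_of_le hat]; exact Icc_subset_Icc hs.1 hτ.2)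

/-- Follow the pair `p` up to time `s` and the pair `q` afterwards. -/
def concat (p : AdmissiblePair tf U ftil a x0) {s : ℝ} (hs : s ∈ Icc a tf)
    (q : AdmissiblePair tf U ftil s (p.x s))
    (hp : IntervalIntegrable (fun τ => ftil τ (p.x τ) (p.u τ)) volume a tf)
    (hq : IntervalIntegrable (fun τ => ftil τ (q.x τ) (q.u τ)) volume s tf) :
    AdmissiblePair tf U ftil a x0 where
  x τ := if τ ≤ s then p.x τ else q.x τ
  u τ := if τ ≤ s then p.u τ else q.u τ
  u_mem τ hτ := by
    split_ifs with h
    · exact p.u_mem τ hτ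
    · exact q.u_mem τ ⟨(not_le.1 h).le, hτ.2⟩
  u_meas := by
    have hm : Measurable (IccExtend hs.2 ((Icc s tf).domRestrict q.u)) :=
      q.u_meas.comp continuous_projIcc.measurable
    have hs' : MeasurableSet {τ : Icc a tf | (τ : ℝ) ≤ s} :=
      measurableSet_le measurable_subtype_coe measurable_const
    have heq : ((fun τ : Icc a tf => if (τ : ℝ) ≤ s then p.u τ else q.u τ)) =
        fun τ : Icc a tf => if (τ : ℝ) ≤ s then p.u τ else
          IccExtend hs.2 ((Icc s tf).domRestrict q.u) τ := by
      funext τ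
      split_ifs with h
      · rfl
      · rw [IccExtend_of_mem _ _ ⟨(not_le.1 h).le, τ.2.2⟩, domRestrict_apply]
    change Measurable fun τ : Icc a tf => if (τ : ℝ) ≤ s then p.u τ else q.u τ
    rw [heq]
    exact Measurable.ite hs' p.u_meas (hm.comp measurable_subtype_coe)
  x_cont := by
    rw [← Icc_union_Icc_eq_Icc hs.1 hs.2]
    refine ContinuousOn.union_of_isClosed ?_ ?_ isClosed_Icc isClosed_Icc
    · exact (p.x_cont.mono (Icc_subset_Icc_right hs.2)).congr fun τ hτ => if_pos hτ.2
    · refine q.x_cont.congr fun τ hτ => ?_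
      rcases hτ.1.eq_or_lt with rfl | h
      · simp [q.x_initial hs.2]
      · simp [not_le.2 h]
  x_eq τ hτ := by
    have hat : a ≤ tf := hs.1.trans hs.2
    have hleft : ∀ σ ≤ s, ftil σ (if σ ≤ s then p.x σ else q.x σ)
        (if σ ≤ s then p.u σ else q.u σ) = ftil σ (p.x σ) (p.u σ) := fun σ hσ => by
      simp [hσ]
    have hright : ∀ σ, s < σ → ftil σ (if σ ≤ s then p.x σ else q.x σ)
        (if σ ≤ s then p.u σ else q.u σ) = ftil σ (q.x σ) (q.u σ) := fun σ hσ => by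
      simp [not_le.2 hσ]
    by_cases h : τ ≤ s
    · rw [if_pos h, p.x_eq τ hτ, intervalIntegral.integral_congr_Ioo_of_le hτ.1]
      exact fun σ hσ => (hleft σ (hσ.2.le.trans h)).symm
    · have hsτ : s < τ := not_le.1 h
      have h1 : IntervalIntegrable (fun σ => ftil σ (p.x σ) (p.u σ)) volume a s :=
        hp.mono_set (by
          rw [uIcc_of_le hs.1, uIcc_of_le hat]; exact Icc_subset_Icc_right hs.2)
      have h2 : IntervalIntegrable (fun σ => ftil σ (q.x σ) (q.u σ)) volume s τ :=
        hq.mono_set (by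
          rw [uIcc_of_le hsτ.le, uIcc_of_le hs.2]; exact Icc_subset_Icc_right hτ.2)
      rw [if_neg h, q.x_eq τ ⟨hsτ.le, hτ.2⟩]
      refine (congrArg (· + _) (p.x_eq s hs)).trans ?_
      rw [add_assoc]
      congr 1
      refine Eq.trans ?_ (intervalIntegral.integral_add_adjacent_intervals (b := s) ?_ ?_)
      · exact congrArg₂ (· + ·)
          (intervalIntegral.integral_congr_Ioo_of_le hs.1 fun σ hσ => (hleft σ hσ.2.le).symm)
          (intervalIntegral.integral_congr_Ioo_of_le hsτ.le fun σ hσ => (hright σ hσ.1).symm)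
      · refine h1.congr fun σ hσ => ?_
        rw [uIoc_of_le hs.1] at hσ
        exact (hleft σ hσ.2).symm
      · refine h2.congr fun σ hσ => ?_
        rw [uIoc_of_le hsτ.le] at hσ
        exact (hright σ hσ.1).symm

/-- **Principle of optimality**: the tail of an optimal pair is optimal. -/
theorem value_eq_of_optimal {r : ℕ} {v : Fin r → ℝ}
    {g : Fin r → ℝ → EuclideanSpace ℝ (Fin n) → EuclideanSpace ℝ (Fin m) → ℝ}
    {h : EuclideanSpace ℝ (Fin n) → ℝ}
    (p : AdmissiblePair tf U ftil a x0) (hUc : IsCompact U) (hv : ∀ j, 0 < v j)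
    (hftil : Continuous fun p : ℝ × EuclideanSpace ℝ (Fin n) × EuclideanSpace ℝ (Fin m) =>
      ftil p.1 p.2.1 p.2.2)
    (hg : ∀ j, Continuous fun p : ℝ × EuclideanSpace ℝ (Fin n) × EuclideanSpace ℝ (Fin m) =>
      g j p.1 p.2.1 p.2.2)
    (hopt : ((fracCost tf v g h p : ℝ) : EReal) = fracValue tf U ftil v g h a x0)
    {s : ℝ} (hs : s ∈ Icc a tf) :
    fracValue tf U ftil v g h s (p.x s) =
      (((∫ τ in s..tf, fracRunningCost tf v g p.x p.u τ) + h (p.x tf) : ℝ) : EReal) := by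
  have hat : a ≤ tf := hs.1.trans hs.2
  have hp := p.intervalIntegrable_dynamics hat hUc hftil
  refine le_antisymm ?_ (le_iInf fun q => ?_)
  · have := iInf_le (fun q : AdmissiblePair tf U ftil s (p.x s) =>
      ((fracCost tf v g h q : ℝ) : EReal)) (p.tail hs hp)
    rwa [(p.tail hs hp).fracCost_eq hs.2 hUc hv hg] at this
  · set c := p.concat hs q hp (q.intervalIntegrable_dynamics hs.2 hUc hftil) with hc
    have hle : fracCost tf v g h p ≤ fracCost tf v g h c := by
      rw [← EReal.coe_le_coe_iff, hopt]
      exact iInf_le (fun q : AdmissiblePair tf U ftil a x0 =>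
        ((fracCost tf v g h q : ℝ) : EReal)) c
    have split : ∀ w : AdmissiblePair tf U ftil a x0,
        (∫ τ in a..s, fracRunningCost tf v g w.x w.u τ) +
          (∫ τ in s..tf, fracRunningCost tf v g w.x w.u τ) =
          ∫ τ in a..tf, fracRunningCost tf v g w.x w.u τ := fun w => by
      have hw := w.intervalIntegrable_fracRunningCost hat hUc hv hg
      refine intervalIntegral.integral_add_adjacent_intervals (hw.mono_set ?_)
        (hw.mono_set ?_)
      · rw [uIcc_of_le hs.1, uIcc_of_le hat]; exact Icc_subset_Icc_right hs.2
      · rw [uIcc_of_le hs.2, uIcc_of_le hat]; exact Icc_subset_Icc_left hs.1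
    have hleft : (∫ τ in a..s, fracRunningCost tf v g c.x c.u τ) =
        ∫ τ in a..s, fracRunningCost tf v g p.x p.u τ :=
      intervalIntegral.integral_congr_Ioo_of_le hs.1 fun σ hσ => by
        simp [fracRunningCost, hc, concat, hσ.2.le]
    have hright : (∫ τ in s..tf, fracRunningCost tf v g c.x c.u τ) =
        ∫ τ in s..tf, fracRunningCost tf v g q.x q.u τ :=
      intervalIntegral.integral_congr_Ioo_of_le hs.2 fun σ hσ => by
        simp [fracRunningCost, hc, concat, not_le.2 hσ.1]
    have hend : c.x tf = q.x tf := by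
      change (if tf ≤ s then p.x tf else q.x tf) = q.x tf
      split_ifs with hts
      · obtain rfl := le_antisymm hs.2 hts
        exact (q.x_initial le_rfl).symm
      · rfl
    rw [EReal.coe_le_coe_iff, q.fracCost_eq hs.2 hUc hv hg]
    rw [p.fracCost_eq hat hUc hv hg, c.fracCost_eq hat hUc hv hg, ← split p, ← split c,
      hleft, hright, hend] at hle
    linarith

end AdmissiblePair

open RealInnerProductSpace in
/-- **Supersolution inequality for the fractional HJB equation along an optimal
trajectory.** Assume the value function is real-valued (equal to `V`) on
`[t₀, t_f] × ℝⁿ` and let `(x*, u*)` be an optimal admissible pair from `(t₀, x₀)`,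
i.e. `J(t₀, x₀; x*, u*) = V(t₀, x₀)`. If `t ∈ [t₀, t_f)` is such that `V` is
differentiable at `(t, x*(t))` and `u*` is right-continuous at `t`, then
`∂V/∂t (t,x*(t)) + Σ_j (1/Γ(v_j)) (t_f - t)^(v_j-1) g_j(t,x*(t),u*(t))
  + ⟨∇ₓV(t,x*(t)), f̃(t,x*(t),u*(t))⟩ ≤ 0`. -/
theorem fracHJB_supersolution_inequality
    (t0 tf : ℝ) (ht0f : t0 < tf) (n m : ℕ)
    (U : Set (EuclideanSpace ℝ (Fin m))) (hUc : IsCompact U) (hUne : U.Nonempty)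
    (ftil : ℝ → EuclideanSpace ℝ (Fin n) → EuclideanSpace ℝ (Fin m) →
      EuclideanSpace ℝ (Fin n))
    (hftil : Continuous fun p : ℝ × EuclideanSpace ℝ (Fin n) × EuclideanSpace ℝ (Fin m) =>
      ftil p.1 p.2.1 p.2.2)
    (r : ℕ) (hr : 1 ≤ r) (v : Fin r → ℝ) (hv : ∀ j, 0 < v j)
    (g : Fin r → ℝ → EuclideanSpace ℝ (Fin n) → EuclideanSpace ℝ (Fin m) → ℝ)
    (hg : ∀ j, Continuous fun p : ℝ × EuclideanSpace ℝ (Fin n) × EuclideanSpace ℝ (Fin m) =>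
      g j p.1 p.2.1 p.2.2)
    (h : EuclideanSpace ℝ (Fin n) → ℝ) (hh : Continuous h)
    (V : ℝ → EuclideanSpace ℝ (Fin n) → ℝ)
    (hV : ∀ s ∈ Set.Icc t0 tf, ∀ y, ((V s y : ℝ) : EReal) = fracValue tf U ftil v g h s y)
    (x0 : EuclideanSpace ℝ (Fin n)) (pstar : AdmissiblePair tf U ftil t0 x0)
    (hopt : fracCost tf v g h pstar = V t0 x0)
    (t : ℝ) (ht : t ∈ Set.Ico t0 tf)
    (hVdiff : DifferentiableAt ℝ (fun p : ℝ × EuclideanSpace ℝ (Fin n) => V p.1 p.2)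
      (t, pstar.x t))
    (hu_rc : ContinuousWithinAt pstar.u (Set.Ici t) t) :
    deriv (fun s => V s (pstar.x t)) t
        + (∑ j, (1 / Real.Gamma (v j)) * (tf - t) ^ (v j - 1) *
            g j t (pstar.x t) (pstar.u t))
        + ⟪gradient (fun y => V t y) (pstar.x t), ftil t (pstar.x t) (pstar.u t)⟫ ≤ 0 := by
  have hle := ht0f.le
  have htI : t ∈ Icc t0 tf := ⟨ht.1, ht.2.le⟩
  have hsub : Icc t tf ⊆ Icc t0 tf := Icc_subset_Icc_left ht.1
  have hnhds : Icc t0 tf ∈ nhdsWithin t (Ici t) :=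
    Filter.mem_of_superset (Icc_mem_nhdsGE ht.2) hsub
  have hnhds' : Icc t0 tf ∈ nhdsWithin t (Ioi t) :=
    nhdsWithin_mono t Ioi_subset_Ici_self hnhds
  have hx : ContinuousWithinAt pstar.x (Ici t) t :=
    (pstar.x_cont t htI).mono_of_mem_nhdsWithin hnhds
  have hL := pstar.intervalIntegrable_fracRunningCost hle hUc hv hg
  have hf := pstar.intervalIntegrable_dynamics hle hUc hftil
  have hLc : ContinuousWithinAt (fracRunningCost tf v g pstar.x pstar.u) (Ici t) t :=
    fracRunningCost_continuousWithinAt hg ht.2 hx hu_rc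
  have hfc : ContinuousWithinAt (fun τ => ftil τ (pstar.x τ) (pstar.u τ)) (Ici t) t :=
    hftil.continuousAt.comp_continuousWithinAt
      (f := fun τ => (τ, pstar.x τ, pstar.u τ)) (continuousWithinAt_id.prodMk (hx.prodMk hu_rc))
  have hLd := intervalIntegral.integral_hasDerivWithinAt_left (s := Ici t) (t := Ioi t)
    (hL.mono_set (by rwa [uIcc_of_le ht.2.le, uIcc_of_le hle]))
    ⟨_, hnhds', ((intervalIntegrable_iff_integrableOn_Icc_of_le hle).1 hL).1⟩
    (hLc.mono Ioi_subset_Ici_self)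
  have hfd := intervalIntegral.integral_hasDerivWithinAt_right (s := Ici t) (t := Ioi t)
    (hf.mono_set (by
      rw [uIcc_of_le ht.1, uIcc_of_le hle]; exact Icc_subset_Icc_right ht.2.le))
    ⟨_, hnhds', ((intervalIntegrable_iff_integrableOn_Icc_of_le hle).1 hf).1⟩
    (hfc.mono Ioi_subset_Ici_self)
  have hxd : HasDerivWithinAt pstar.x (ftil t (pstar.x t) (pstar.u t)) (Ici t) t := by
    refine (hfd.const_add x0).congr_of_eventuallyEq ?_ (pstar.x_eq t htI)
    filter_upwards [hnhds] with s hs using pstar.x_eq s hs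
  set D := fderiv ℝ (fun p : ℝ × EuclideanSpace ℝ (Fin n) => V p.1 p.2) (t, pstar.x t)
  have hD := hVdiff.hasFDerivAt
  have hVd := hD.comp_hasDerivWithinAt (f := fun s => (s, pstar.x s)) t
    ((hasDerivWithinAt_id t (Ici t)).prodMk hxd)
  have hVeq : ∀ s ∈ Icc t0 tf, V s (pstar.x s) =
      (∫ τ in s..tf, fracRunningCost tf v g pstar.x pstar.u τ) + h (pstar.x tf) := by
    intro s hs
    rw [← EReal.coe_eq_coe_iff, hV s hs]
    exact pstar.value_eq_of_optimal hUc hv hftil hg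
      (by rw [hopt, hV t0 (left_mem_Icc.2 hle)]) hs
  have hVd' := (hLd.add_const (h (pstar.x tf))).congr_of_eventuallyEq
    (f₁ := (fun p : ℝ × EuclideanSpace ℝ (Fin n) => V p.1 p.2) ∘ fun s => (s, pstar.x s))
    (by filter_upwards [hnhds] with s hs using hVeq s hs) (hVeq t htI)
  have hkey : D (1, ftil t (pstar.x t) (pstar.u t)) =
      -fracRunningCost tf v g pstar.x pstar.u t :=
    (uniqueDiffWithinAt_Ici t).eq_deriv _ hVd hVd'
  have hdt : deriv (fun s => V s (pstar.x t)) t = D (1, 0) :=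
    (hD.comp_hasDerivAt (f := fun s => (s, pstar.x t)) t
      ((hasDerivAt_id t).prodMk (hasDerivAt_const t (pstar.x t)))).deriv
  have hdx : ⟪gradient (fun y => V t y) (pstar.x t), ftil t (pstar.x t) (pstar.u t)⟫ =
      D (0, ftil t (pstar.x t) (pstar.u t)) := by
    rw [inner_gradient_left]
    have := (hD.comp (pstar.x t) (hasFDerivAt_prodMk_right t (pstar.x t))).fderiv
    exact (DFunLike.congr_fun this _).trans (by simp [D])
  have hadd : D (1, ftil t (pstar.x t) (pstar.u t)) =
      D (1, 0) + D (0, ftil t (pstar.x t) (pstar.u t)) := by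
    rw [← map_add]; simp
  have hrun : (∑ j, (1 / Real.Gamma (v j)) * (tf - t) ^ (v j - 1) *
      g j t (pstar.x t) (pstar.u t)) = fracRunningCost tf v g pstar.x pstar.u t := by
    simp only [fracRunningCost, mul_assoc]
  rw [hdt, hdx, hrun]
  linarith
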